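/- Fix 2 ≤ s < ∞ and let V f(x) = (∑_{n∈ℤ} |A_n f(x) − A_{n-1} f(x)|^s)^{1/s} with A_n f(x) = 2^{-n} ∫_x^{x+2^n} f(y) dy. Then there exists C > 0 such that for every compactly supported f ∈ L^∞(ℝ), ‖V f‖_{BMO(ℝ)} ≤ C ‖f‖_{L^∞}. -/

import Mathlib

open MeasureTheory Set Real

/-- The averaging operator `A_n f(x) = 2^{-n} ∫_x^{x+2^n} f`. -/
noncomputable def Aop (n : ℤ) (f : ℝ → ℝ) (x : ℝ) : ℝ :=
  ((2:ℝ)^n)⁻¹ * ∫ y in x..(x + (2:ℝ)^n), f y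

/-- The variation operator. -/
noncomputable def Vop (s : ℝ) (f : ℝ → ℝ) (x : ℝ) : ℝ :=
  (∑' n : ℤ, |Aop n f x - Aop (n-1) f x| ^ s) ^ (1/s)

lemma aux_intg {f : ℝ → ℝ} {M : ℝ} (hf : Measurable f) (hM : ∀ x, |f x| ≤ M) (a b : ℝ) :
    IntervalIntegrable f volume a b := by
  refine (intervalIntegrable_const (c := M)).mono_fun hf.aestronglyMeasurable ?_
  refine Filter.Eventually.of_forall fun x => ?_
  simp only [Real.norm_eq_abs]
  exact (hM x).trans (le_abs_self M)

lemma aux_A_cont {f : ℝ → ℝ} {M : ℝ} (hf : Measurable f) (hM : ∀ x, |f x| ≤ M) (n : ℤ) :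
    Continuous (Aop n f) := by
  have h : Continuous fun x => ∫ y in (0:ℝ)..x, f y :=
    intervalIntegral.continuous_primitive (aux_intg hf hM) 0
  have : Aop n f = fun x => ((2:ℝ)^n)⁻¹ *
      ((∫ y in (0:ℝ)..(x + (2:ℝ)^n), f y) - ∫ y in (0:ℝ)..x, f y) := by
    funext x
    rw [intervalIntegral.integral_interval_sub_left (aux_intg hf hM _ _) (aux_intg hf hM _ _)]
    rfl
  rw [this]
  exact continuous_const.mul ((h.comp (continuous_id.add continuous_const)).sub h)

lemma aux_A_bd {f : ℝ → ℝ} {M : ℝ} (hM : ∀ x, |f x| ≤ M) (n : ℤ) (x : ℝ) :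
    |Aop n f x| ≤ M := by
  have hp : (0:ℝ) < 2^n := by positivity
  have h := intervalIntegral.norm_integral_le_of_norm_le_const (a := x) (b := x + (2:ℝ)^n)
    (f := f) (C := M) (fun y _ => hM y)
  rw [Real.norm_eq_abs, add_sub_cancel_left, abs_of_pos hp] at h
  unfold Aop
  rw [abs_mul, abs_of_pos (inv_pos.2 hp), inv_mul_le_iff₀ hp]
  linarith

lemma aux_A_lip {f : ℝ → ℝ} {M : ℝ} (hf : Measurable f) (hM : ∀ x, |f x| ≤ M) (n : ℤ)
    {a x L : ℝ} (hx : |x - a| ≤ L) :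
    |Aop n f x - Aop n f a| ≤ 2 * M * L * ((2:ℝ)^n)⁻¹ := by
  have hp : (0:ℝ) < 2^n := by positivity
  have hM0 : 0 ≤ M := (abs_nonneg _).trans (hM 0)
  have e : Aop n f x - Aop n f a = ((2:ℝ)^n)⁻¹ *
      ((∫ y in (a + (2:ℝ)^n)..(x + (2:ℝ)^n), f y) - ∫ y in a..x, f y) := by
    unfold Aop
    rw [← mul_sub]
    congr 1
    have h1 := intervalIntegral.integral_add_adjacent_intervals
      (aux_intg hf hM a x) (aux_intg hf hM x (x + (2:ℝ)^n))
    have h2 := intervalIntegral.integral_add_adjacent_intervals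
      (aux_intg hf hM a (a + (2:ℝ)^n)) (aux_intg hf hM (a + (2:ℝ)^n) (x + (2:ℝ)^n))
    linarith
  have h1 := intervalIntegral.norm_integral_le_of_norm_le_const (a := a) (b := x)
    (f := f) (C := M) (fun y _ => hM y)
  have h2 := intervalIntegral.norm_integral_le_of_norm_le_const
    (a := a + (2:ℝ)^n) (b := x + (2:ℝ)^n) (f := f) (C := M) (fun y _ => hM y)
  rw [add_sub_add_right_eq_sub] at h2
  rw [Real.norm_eq_abs] at h1 h2
  have h3 : M * |x - a| ≤ M * L := mul_le_mul_of_nonneg_left hx hM0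
  rw [e, abs_mul, abs_of_pos (inv_pos.2 hp), mul_comm]
  refine mul_le_mul_of_nonneg_right ?_ (inv_pos.2 hp).le
  exact (abs_sub _ _).trans (by linarith)

lemma aux_A_half {f : ℝ → ℝ} {M : ℝ} (hf : Measurable f) (hM : ∀ x, |f x| ≤ M) (n : ℤ) (x : ℝ) :
    Aop n f x = (Aop (n-1) f x + Aop (n-1) f (x + (2:ℝ)^(n-1))) / 2 := by
  have e : (2:ℝ)^n = 2 * (2:ℝ)^(n-1) := by
    rw [← zpow_one_add₀ (two_ne_zero)]; congr 1; ring
  unfold Aop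
  rw [e]
  generalize hh : (2:ℝ)^(n-1) = h
  have hp : 0 < h := by rw [← hh]; positivity
  have h1 := intervalIntegral.integral_add_adjacent_intervals
    (aux_intg hf hM x (x + h)) (aux_intg hf hM (x + h) (x + h + h))
  rw [show x + 2 * h = x + h + h by ring, ← h1, mul_inv]
  ring

/-- one step of the telescoping square function estimate -/
lemma aux_step {f : ℝ → ℝ} {M : ℝ} (hf : Measurable f) (hM : ∀ x, |f x| ≤ M) (n : ℤ)
    {a b : ℝ} (hab : a < b) :
    ∫ x in a..b, (Aop n f x - Aop (n-1) f x)^2 ≤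
      (∫ x in a..b, (Aop (n-1) f x)^2) - (∫ x in a..b, (Aop n f x)^2)
        + (2:ℝ)^(n-1) * M^2 := by
  set h : ℝ := (2:ℝ)^(n-1) with hh
  have hp : 0 < h := by positivity
  have c0 := aux_A_cont hf hM n
  have c1 := aux_A_cont hf hM (n-1)
  have key : ∀ x, (Aop n f x - Aop (n-1) f x)^2 =
      (Aop (n-1) f x)^2 / 2 + (Aop (n-1) f (x+h))^2 / 2 - (Aop n f x)^2 := by
    intro x
    rw [aux_A_half hf hM n x, ← hh]
    ring
  have c2 : Continuous fun x => (Aop (n-1) f x)^2 := c1.pow 2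
  have c3 : Continuous fun x => (Aop (n-1) f (x+h))^2 :=
    c2.comp (continuous_id.add continuous_const)
  have c4 : Continuous fun x => (Aop n f x)^2 := c0.pow 2
  have c5 : Continuous fun x => (Aop (n-1) f x)^2 / 2 + (Aop (n-1) f (x+h))^2 / 2 :=
    (c2.div_const 2).add (c3.div_const 2)
  simp only [key]
  rw [intervalIntegral.integral_sub
    (c5.intervalIntegrable _ _) (c4.intervalIntegrable _ _),
    intervalIntegral.integral_add ((c2.div_const 2).intervalIntegrable _ _)
      ((c3.div_const 2).intervalIntegrable _ _),
    intervalIntegral.integral_div, intervalIntegral.integral_div,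
    intervalIntegral.integral_comp_add_right (fun x => (Aop (n-1) f x)^2) h]
  have i1 := intervalIntegral.integral_add_adjacent_intervals
    (c2.intervalIntegrable (μ := volume) a (a+h)) (c2.intervalIntegrable (a+h) (b+h))
  have i2 := intervalIntegral.integral_add_adjacent_intervals
    (c2.intervalIntegrable (μ := volume) a b) (c2.intervalIntegrable b (b+h))
  have i3 : 0 ≤ ∫ x in a..(a+h), (Aop (n-1) f x)^2 :=
    intervalIntegral.integral_nonneg (by linarith) (fun x _ => sq_nonneg _)
  have i4 : ∫ x in b..(b+h), (Aop (n-1) f x)^2 ≤ h * M^2 := by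
    have := intervalIntegral.integral_mono_on (μ := volume) (a := b) (b := b+h) (by linarith)
      (c2.intervalIntegrable b (b+h)) (intervalIntegrable_const (c := M^2))
      (fun x _ => sq_le_sq' (by linarith [(abs_le.1 (aux_A_bd hM (n-1) x)).1])
        (abs_le.1 (aux_A_bd hM (n-1) x)).2)
    simpa using this
  have : 0 ≤ h * M^2 := by positivity
  linarith

lemma aux_tele {f : ℝ → ℝ} {M : ℝ} (hf : Measurable f) (hM : ∀ x, |f x| ≤ M) (N : ℤ)
    {a b : ℝ} (hab : a < b) (J : ℕ) :
    ∑ j ∈ Finset.range J, ∫ x in a..b, (Aop (N-j) f x - Aop (N-j-1) f x)^2 ≤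
      (∫ x in a..b, (Aop (N-J) f x)^2) - (∫ x in a..b, (Aop N f x)^2)
        + ((2:ℝ)^N - (2:ℝ)^(N-J)) * M^2 := by
  induction J with
  | zero => simp
  | succ J ih =>
    rw [Finset.sum_range_succ]
    have := aux_step hf hM (N-J) hab
    have e : (N - ((J+1 : ℕ):ℤ)) = N - J - 1 := by push_cast; ring
    have e2 : (2:ℝ)^(N-J) = 2 * (2:ℝ)^(N-J-1) := by
      rw [← zpow_one_add₀ (two_ne_zero)]; congr 1; ring
    rw [e]
    rw [e2] at ih
    nlinarith

lemma aux_small {f : ℝ → ℝ} {M : ℝ} (hf : Measurable f) (hM : ∀ x, |f x| ≤ M) (N : ℤ)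
    {a b : ℝ} (hab : a < b) (hN : (2:ℝ)^N ≤ b - a) (J : ℕ) :
    ∑ j ∈ Finset.range J, ∫ x in a..b, (Aop (N-j) f x - Aop (N-j-1) f x)^2 ≤
      2 * M^2 * (b - a) := by
  have h := aux_tele hf hM N hab J
  have c := aux_A_cont hf hM (N-J)
  have i4 : ∫ x in a..b, (Aop (N-J) f x)^2 ≤ (b - a) * M^2 := by
    have := intervalIntegral.integral_mono_on (μ := volume) (a := a) (b := b) hab.le
      ((c.pow 2).intervalIntegrable a b) (intervalIntegrable_const (c := M^2))
      (fun x _ => sq_le_sq' (by linarith [(abs_le.1 (aux_A_bd hM (N-J) x)).1])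
        (abs_le.1 (aux_A_bd hM (N-J) x)).2)
    simpa using this
  have i3 : 0 ≤ ∫ x in a..b, (Aop N f x)^2 :=
    intervalIntegral.integral_nonneg hab.le (fun x _ => sq_nonneg _)
  have p : (0:ℝ) < (2:ℝ)^(N-J) := by positivity
  nlinarith [sq_nonneg M]

lemma aux_mink {s : ℝ} (hs : 1 ≤ s) (u w : ℤ → ℝ) (h : Summable fun n => |u n - w n| ^ s) :
    |(∑' n, |u n| ^ s) ^ (1/s) - (∑' n, |w n| ^ s) ^ (1/s)| ≤ (∑' n, |u n - w n| ^ s) ^ (1/s) := by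
  have hs0 : 0 < s := by linarith
  set p : ENNReal := ENNReal.ofReal s with hpdef
  have hp : p.toReal = s := ENNReal.toReal_ofReal hs0.le
  have hp0 : 0 < p.toReal := by rw [hp]; exact hs0
  haveI : Fact (1 ≤ p) := ⟨by rw [hpdef]; exact ENNReal.one_le_ofReal.2 hs⟩
  have mem : ∀ v : ℤ → ℝ, Memℓp v p ↔ Summable fun n => |v n| ^ s := by
    intro v
    rw [memℓp_gen_iff hp0, hp]
    rfl
  have hd : Memℓp (u - w) p := (mem _).2 h
  by_cases hw : Memℓp w p
  · have hu : Memℓp u p := by simpa using hd.add hw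
    let U : lp (fun _ : ℤ => ℝ) p := ⟨u, hu⟩
    let W : lp (fun _ : ℤ => ℝ) p := ⟨w, hw⟩
    have nU : ‖U‖ = (∑' n, |u n| ^ s) ^ (1/s) := by
      rw [lp.norm_eq_tsum_rpow hp0, hp]; rfl
    have nW : ‖W‖ = (∑' n, |w n| ^ s) ^ (1/s) := by
      rw [lp.norm_eq_tsum_rpow hp0, hp]; rfl
    have nD : ‖U - W‖ = (∑' n, |u n - w n| ^ s) ^ (1/s) := by
      rw [lp.norm_eq_tsum_rpow hp0, hp]; rfl
    rw [← nU, ← nW, ← nD]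
    exact abs_norm_sub_norm_le U W
  · have hu : ¬ Memℓp u p := fun hu => hw (by simpa using hu.sub hd)
    rw [tsum_eq_zero_of_not_summable (fun h => hw ((mem _).2 h)),
      tsum_eq_zero_of_not_summable (fun h => hu ((mem _).2 h)), sub_self, abs_zero]
    exact Real.rpow_nonneg (tsum_nonneg fun n => Real.rpow_nonneg (abs_nonneg _) _) _

lemma aux_pt {s : ℝ} (hs : 2 ≤ s) {B : ℝ} (hB : 0 < B) (u w : ℤ → ℝ)
    (hb : ∀ n, |u n - w n| ≤ B) (h : Summable fun n => (u n - w n) ^ 2) :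
    |(∑' n, |u n| ^ s) ^ (1/s) - (∑' n, |w n| ^ s) ^ (1/s)| ≤
      B + (∑' n, (u n - w n) ^ 2) / B := by
  have hs0 : 0 < s := by linarith
  have le : ∀ n, |u n - w n| ^ s ≤ B ^ s * ((u n - w n)^2 / B^2) := by
    intro n
    have h0 : 0 ≤ |u n - w n| / B := by positivity
    have h1 : |u n - w n| / B ≤ 1 := (div_le_one hB).2 (hb n)
    have : (|u n - w n| / B) ^ s ≤ (|u n - w n| / B) ^ (2:ℝ) :=
      Real.rpow_le_rpow_of_exponent_ge_of_imp h0 h1 hs (by intros; linarith)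
    rw [Real.rpow_two, Real.div_rpow (abs_nonneg _) hB.le, div_pow, sq_abs,
      div_le_iff₀ (by positivity)] at this
    linarith
  have sm : Summable fun n => B ^ s * ((u n - w n)^2 / B^2) := (h.div_const _).mul_left _
  have sm' : Summable fun n => |u n - w n| ^ s :=
    Summable.of_nonneg_of_le (fun n => Real.rpow_nonneg (abs_nonneg _) _) le sm
  refine (aux_mink (by linarith) u w sm').trans ?_
  set T := ∑' n, (u n - w n) ^ 2 with hT
  have hT0 : 0 ≤ T := tsum_nonneg fun n => sq_nonneg _
  have e : ∑' n, |u n - w n| ^ s ≤ B ^ s * (T / B^2) := by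
    refine (sm'.tsum_le_tsum le sm).trans_eq ?_
    rw [tsum_mul_left, tsum_div_const]
  calc _ ≤ (B ^ s * (T / B^2)) ^ (1/s) := Real.rpow_le_rpow
          (tsum_nonneg fun n => Real.rpow_nonneg (abs_nonneg _) _) e (by positivity)
    _ = B * (T / B^2) ^ (1/s) := by
          rw [Real.mul_rpow (by positivity) (by positivity), ← Real.rpow_mul hB.le,
            mul_one_div_cancel hs0.ne', Real.rpow_one]
    _ ≤ B * (1 + T / B^2) := by
          refine mul_le_mul_of_nonneg_left ?_ hB.le
          have h0 : 0 ≤ T / B^2 := by positivity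
          calc (T / B^2) ^ (1/s) ≤ (1 + T / B^2) ^ (1/s) :=
                Real.rpow_le_rpow h0 (by linarith) (by positivity)
            _ ≤ (1 + T / B^2) ^ (1:ℝ) := Real.rpow_le_rpow_of_exponent_le (by linarith)
                ((div_le_one hs0).2 (by linarith))
            _ = _ := Real.rpow_one _
    _ = B + T / B := by field_simp

lemma aux_meas {s : ℝ} {f : ℝ → ℝ} {M : ℝ} (hf : Measurable f) (hM : ∀ x, |f x| ≤ M) :
    Measurable (Vop s f) := by
  have : Vop s f = fun x => (∑' n : ℤ,
      ENNReal.ofReal (|Aop n f x - Aop (n-1) f x| ^ s)).toReal ^ (1/s) := by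
    funext x
    rw [ENNReal.tsum_toReal_eq (fun _ => ENNReal.ofReal_ne_top)]
    unfold Vop
    congr 2
    funext n
    rw [ENNReal.toReal_ofReal (Real.rpow_nonneg (abs_nonneg _) _)]
  rw [this]
  have m : ∀ n : ℤ, Measurable (Aop n f) := fun n => (aux_A_cont hf hM n).measurable
  have : Measurable fun x => ∑' n : ℤ, ENNReal.ofReal (|Aop n f x - Aop (n-1) f x| ^ s) := by
    refine Measurable.ennreal_tsum fun n => ?_
    have := ((m n).sub (m (n-1))).norm.pow_const s
    exact this.ennreal_ofReal
  exact this.ennreal_toReal.pow_const _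

lemma aux_lint {f : ℝ → ℝ} {M : ℝ} (hf : Measurable f) (hM : ∀ x, |f x| ≤ M) (N : ℤ)
    {a b : ℝ} (hab : a < b) (hN : (2:ℝ)^N ≤ b - a) (hN' : b - a < (2:ℝ)^(N+1)) :
    ∫⁻ x in Ioc a b, ∑' n : ℤ, ENNReal.ofReal ((Aop n f x - Aop (n-1) f x -
      if N < n then Aop n f a - Aop (n-1) f a else 0)^2) ≤
      ENNReal.ofReal (50 * M^2 * (b - a)) := by
  have m : ∀ n : ℤ, Measurable (Aop n f) := fun n => (aux_A_cont hf hM n).measurable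
  have hM0 : 0 ≤ M := (abs_nonneg _).trans (hM 0)
  have mm : ∀ n : ℤ, Measurable fun x => ENNReal.ofReal ((Aop n f x - Aop (n-1) f x -
      if N < n then Aop n f a - Aop (n-1) f a else 0)^2) := fun n =>
    ((((m n).sub (m (n-1))).sub measurable_const).pow_const 2).ennreal_ofReal
  rw [lintegral_tsum (fun n => (mm n).aemeasurable)]
  rw [← (Equiv.addRight (N+1)).tsum_eq, tsum_of_nat_of_neg_add_one ENNReal.summable
    ENNReal.summable]
  have hlarge : ∑' j : ℕ, ∫⁻ x in Ioc a b, ENNReal.ofReal ((Aop (Equiv.addRight (N+1) (j:ℤ)) f x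
      - Aop (Equiv.addRight (N+1) (j:ℤ) - 1) f x -
      if N < Equiv.addRight (N+1) (j:ℤ) then Aop (Equiv.addRight (N+1) (j:ℤ)) f a -
        Aop (Equiv.addRight (N+1) (j:ℤ) - 1) f a else 0)^2) ≤
      ENNReal.ofReal (48 * M^2 * (b - a)) := by
    have hb : ∀ j : ℕ, ∫⁻ x in Ioc a b, ENNReal.ofReal ((Aop (Equiv.addRight (N+1) (j:ℤ)) f x
      - Aop (Equiv.addRight (N+1) (j:ℤ) - 1) f x -
      if N < Equiv.addRight (N+1) (j:ℤ) then Aop (Equiv.addRight (N+1) (j:ℤ)) f a -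
        Aop (Equiv.addRight (N+1) (j:ℤ) - 1) f a else 0)^2) ≤
        ENNReal.ofReal (36 * M^2 * (b-a) * (1/4)^j) := by
      intro j
      have hlt : N < Equiv.addRight (N+1) (j:ℤ) := by
        simp only [Equiv.coe_addRight]; omega
      simp only [if_pos hlt]
      simp only [Equiv.coe_addRight]
      set n : ℤ := (j:ℤ) + (N+1) with hn
      have hbd : ∀ x ∈ Ioc a b, ENNReal.ofReal ((Aop n f x - Aop (n-1) f x -
          (Aop n f a - Aop (n-1) f a))^2) ≤ ENNReal.ofReal (36 * M^2 * (1/4)^j) := by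
        intro x hx
        apply ENNReal.ofReal_le_ofReal
        have hxa : |x - a| ≤ (2:ℝ)^(N+1) := by
          rw [abs_of_nonneg (by linarith [hx.1])]; linarith [hx.2]
        have l1 := aux_A_lip hf hM n hxa
        have l2 := aux_A_lip hf hM (n-1) hxa
        have p1 : (0:ℝ) < 2^(N+1) := by positivity
        have e1 : (2:ℝ)^n = 2^j * 2^(N+1) := by
          rw [hn, zpow_add₀ two_ne_zero, zpow_natCast]
        have e2 : (2:ℝ)^(n-1) = 2^j * 2^(N+1) / 2 := by
          rw [zpow_sub_one₀ two_ne_zero, e1]; rfl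
        have q1 : 2 * M * (2:ℝ)^(N+1) * ((2:ℝ)^n)⁻¹ = 2 * M * (1/2)^j := by
          rw [e1, one_div, inv_pow]; field_simp
        have q2 : 2 * M * (2:ℝ)^(N+1) * ((2:ℝ)^(n-1))⁻¹ = 4 * M * (1/2)^j := by
          rw [e2, one_div, inv_pow]; field_simp; ring
        rw [q1] at l1
        rw [q2] at l2
        have e4 : (36 * M^2 * (1/4)^j : ℝ) = (6 * M * (1/2)^j)^2 := by
          rw [mul_pow, mul_pow, ← pow_mul, mul_comm j 2, pow_mul]; norm_num
        rw [e4]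
        rw [abs_le] at l1 l2
        apply sq_le_sq' <;> linarith [l1.1, l1.2, l2.1, l2.2]
      calc _ ≤ ∫⁻ x in Ioc a b, ENNReal.ofReal (36 * M^2 * (1/4)^j) :=
            setLIntegral_mono measurable_const hbd
        _ = ENNReal.ofReal (36 * M^2 * (b-a) * (1/4)^j) := by
            rw [setLIntegral_const, Real.volume_Ioc, ← ENNReal.ofReal_mul (by positivity)]
            congr 1; ring
    refine (ENNReal.tsum_le_tsum hb).trans ?_
    have hba : 0 ≤ b - a := by linarith
    have sg : Summable fun j : ℕ => 36 * M^2 * (b-a) * (1/4:ℝ)^j :=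
      (summable_geometric_of_lt_one (by norm_num) (by norm_num)).mul_left _
    rw [← ENNReal.ofReal_tsum_of_nonneg (fun j => by positivity) sg, tsum_mul_left,
      tsum_geometric_of_lt_one (by norm_num) (by norm_num)]
    apply ENNReal.ofReal_le_ofReal
    apply le_of_eq; ring
  have hsmall : ∑' j : ℕ, ∫⁻ x in Ioc a b, ENNReal.ofReal
      ((Aop (Equiv.addRight (N+1) (-((j:ℤ)+1))) f x
      - Aop (Equiv.addRight (N+1) (-((j:ℤ)+1)) - 1) f x -
      if N < Equiv.addRight (N+1) (-((j:ℤ)+1)) then Aop (Equiv.addRight (N+1) (-((j:ℤ)+1))) f a -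
        Aop (Equiv.addRight (N+1) (-((j:ℤ)+1)) - 1) f a else 0)^2) ≤
      ENNReal.ofReal (2 * M^2 * (b - a)) := by
    have hb : ∀ j : ℕ, ∫⁻ x in Ioc a b, ENNReal.ofReal
      ((Aop (Equiv.addRight (N+1) (-((j:ℤ)+1))) f x
      - Aop (Equiv.addRight (N+1) (-((j:ℤ)+1)) - 1) f x -
      if N < Equiv.addRight (N+1) (-((j:ℤ)+1)) then Aop (Equiv.addRight (N+1) (-((j:ℤ)+1))) f a -
        Aop (Equiv.addRight (N+1) (-((j:ℤ)+1)) - 1) f a else 0)^2) =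
        ENNReal.ofReal (∫ x in a..b, (Aop (N-j) f x - Aop (N-j-1) f x)^2) := by
      intro j
      have e : -((j:ℤ)+1) + (N+1) = N - j := by ring
      have hlt : ¬ (N < N - (j:ℤ)) := by omega
      simp only [Equiv.coe_addRight, e, if_neg hlt, sub_zero]
      have c : Continuous fun x => (Aop (N-j) f x - Aop (N-j-1) f x)^2 :=
        ((aux_A_cont hf hM _).sub (aux_A_cont hf hM _)).pow 2
      rw [intervalIntegral.integral_of_le hab.le, ofReal_integral_eq_lintegral_ofReal
        (c.intervalIntegrable a b).1 (Filter.Eventually.of_forall fun x => sq_nonneg _)]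
    simp only [hb]
    rw [ENNReal.tsum_eq_iSup_nat]
    refine iSup_le fun J => ?_
    rw [← ENNReal.ofReal_sum_of_nonneg (fun j _ =>
      intervalIntegral.integral_nonneg hab.le fun x _ => sq_nonneg _)]
    exact ENNReal.ofReal_le_ofReal (aux_small hf hM N hab hN J)
  have hba : 0 ≤ b - a := by linarith
  refine (add_le_add hlarge hsmall).trans ?_
  rw [← ENNReal.ofReal_add (by positivity) (by positivity)]
  apply ENNReal.ofReal_le_ofReal
  apply le_of_eq; ring

lemma aux_main {s : ℝ} (hs : 2 ≤ s) {f : ℝ → ℝ} {M : ℝ} (hf : Measurable f) (hMp : 0 < M)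
    (hM : ∀ x, |f x| ≤ M) {a b : ℝ} (hab : a < b) :
    ∃ c : ℝ, IntegrableOn (fun x => Vop s f x - c) (Ioc a b) ∧
      ∫ x in Ioc a b, |Vop s f x - c| ≤ 20 * M * (b - a) := by
  have hba : 0 < b - a := by linarith
  obtain ⟨N, hN, hN'⟩ := exists_mem_Ico_zpow (x := b - a) (y := (2:ℝ)) hba (by norm_num)
  have hlint := aux_lint hf hM N hab hN hN'
  have m : ∀ n : ℤ, Measurable (Aop n f) := fun n => (aux_A_cont hf hM n).measurable
  set w : ℤ → ℝ := fun n => if N < n then Aop n f a - Aop (n-1) f a else 0 with hw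
  set E : ℝ → ENNReal := fun x => ∑' n : ℤ, ENNReal.ofReal
    ((Aop n f x - Aop (n-1) f x - w n)^2) with hE
  have hlint' : ∫⁻ x in Ioc a b, E x ≤ ENNReal.ofReal (50 * M^2 * (b - a)) := hlint
  have hEm : Measurable E := Measurable.ennreal_tsum fun n =>
    ((((m n).sub (m (n-1))).sub measurable_const).pow_const 2).ennreal_ofReal
  have hEfin : ∀ᵐ x ∂(volume.restrict (Ioc a b)), E x < ⊤ :=
    ae_lt_top hEm (hlint'.trans_lt ENNReal.ofReal_lt_top).ne
  set c := (∑' n, |w n| ^ s) ^ (1/s) with hc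
  have hpt : ∀ᵐ x ∂(volume.restrict (Ioc a b)),
      |Vop s f x - c| ≤ 4 * M + (E x).toReal / (4 * M) := by
    filter_upwards [hEfin] with x hx
    have e1 : (E x).toReal = ∑' n : ℤ, (Aop n f x - Aop (n-1) f x - w n)^2 := by
      rw [hE, ENNReal.tsum_toReal_eq (fun _ => ENNReal.ofReal_ne_top)]
      congr 1; funext n
      exact ENNReal.toReal_ofReal (sq_nonneg _)
    have sm : Summable fun n : ℤ => (Aop n f x - Aop (n-1) f x - w n)^2 := by
      have := ENNReal.summable_toReal hx.ne
      refine this.congr fun n => ?_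
      exact ENNReal.toReal_ofReal (sq_nonneg _)
    rw [e1]
    refine aux_pt hs (by linarith) (fun n => Aop n f x - Aop (n-1) f x) w (fun n => ?_) sm
    have b1 := abs_le.1 (aux_A_bd hM n x)
    have b2 := abs_le.1 (aux_A_bd hM (n-1) x)
    have b3 := abs_le.1 (aux_A_bd hM n a)
    have b4 := abs_le.1 (aux_A_bd hM (n-1) a)
    rw [abs_le]
    simp only [hw]
    split_ifs <;> constructor <;> linarith [b1.1, b1.2, b2.1, b2.2, b3.1, b3.2, b4.1, b4.2]
  have hEi : Integrable (fun x => (E x).toReal) (volume.restrict (Ioc a b)) :=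
    integrable_toReal_of_lintegral_ne_top hEm.aemeasurable
      (hlint'.trans_lt ENNReal.ofReal_lt_top).ne
  have hG : Integrable (fun x => 4 * M + (E x).toReal / (4 * M)) (volume.restrict (Ioc a b)) :=
    (integrable_const _).add (hEi.div_const _)
  have hVi : IntegrableOn (fun x => Vop s f x - c) (Ioc a b) :=
    hG.mono' ((aux_meas hf hM).sub_const c).aestronglyMeasurable hpt
  refine ⟨c, hVi, ?_⟩
  have hEint : ∫ x in Ioc a b, (E x).toReal ≤ 50 * M^2 * (b - a) := by
    rw [integral_toReal hEm.aemeasurable hEfin]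
    exact ENNReal.toReal_le_of_le_ofReal (by positivity) hlint'
  calc _ ≤ ∫ x in Ioc a b, (4 * M + (E x).toReal / (4 * M)) :=
        integral_mono_ae hVi.abs hG hpt
    _ = (b - a) * (4 * M) + (∫ x in Ioc a b, (E x).toReal) / (4 * M) := by
        rw [integral_add (integrable_const _) (hEi.div_const _), integral_div]
        simp [hab.le]
    _ ≤ (b - a) * (4 * M) + (50 * M^2 * (b - a)) / (4 * M) := by gcongr
    _ = (b - a) * (4 * M) + 12.5 * M * (b - a) := by field_simp; norm_num
    _ ≤ _ := by nlinarith [mul_pos hMp hba]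

lemma aux_osc {g : ℝ → ℝ} {a b c K : ℝ} (hab : a < b)
    (hi : IntegrableOn (fun x => g x - c) (Ioc a b))
    (hK : ∫ x in Ioc a b, |g x - c| ≤ K * (b - a)) :
    (b - a)⁻¹ * ∫ x in a..b, |g x - (b - a)⁻¹ * ∫ t in a..b, g t| ≤ 2 * K := by
  have hba : 0 < b - a := by linarith
  rw [intervalIntegral.integral_of_le hab.le, intervalIntegral.integral_of_le hab.le]
  set A := (b - a)⁻¹ * ∫ t in Ioc a b, g t with hA
  have hg : IntegrableOn g (Ioc a b) := by
    have := hi.add (integrable_const (μ := volume.restrict (Ioc a b)) c)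
    refine this.congr (Filter.Eventually.of_forall fun x => ?_)
    simp
  have h1 : ∫ x in Ioc a b, (g x - c) = (b - a) * (A - c) := by
    rw [integral_sub hg (integrable_const _), hA]
    simp [hab.le]
    field_simp
  have h2 : (b - a) * |A - c| ≤ K * (b - a) := by
    have := abs_integral_le_integral_abs (μ := volume.restrict (Ioc a b)) (f := fun x => g x - c)
    rw [h1, abs_mul, abs_of_pos hba] at this
    linarith
  have h3 : ∫ x in Ioc a b, |g x - A| ≤ ∫ x in Ioc a b, (|g x - c| + |A - c|) := by
    refine integral_mono (hg.sub (integrable_const _)).abs (hi.abs.add (integrable_const _))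
      fun x => ?_
    have := abs_sub_le (g x) c A
    rw [abs_sub_comm c A] at this
    exact this
  rw [integral_add hi.abs (integrable_const _)] at h3
  simp [hab.le] at h3
  rw [inv_mul_le_iff₀ hba]
  linarith

/-- `V` maps compactly supported `L^∞` functions to `BMO`: the mean oscillation of `V f`
over every bounded interval is controlled by `‖f‖_∞`. -/
theorem stmt9 (s : ℝ) (hs : 2 ≤ s) :
    ∃ C > 0, ∀ (f : ℝ → ℝ) (M : ℝ), Measurable f → HasCompactSupport f →
      (∀ x, |f x| ≤ M) →
      ∀ a b : ℝ, a < b →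
        (b - a)⁻¹ * ∫ x in a..b,
            |Vop s f x - (b - a)⁻¹ * ∫ t in a..b, Vop s f t|
          ≤ C * M := by
  refine ⟨40, by norm_num, fun f M hf _ hM a b hab => ?_⟩
  refine le_of_forall_pos_le_add fun ε hε => ?_
  have hM0 : 0 ≤ M := (abs_nonneg _).trans (hM 0)
  obtain ⟨c, hi, hK⟩ := aux_main hs (M := M + ε / 40) hf (by positivity)
    (fun x => (hM x).trans (by linarith)) hab
  exact (aux_osc hab hi hK).trans (by linarith)
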